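/- arXiv:2505.01989 — 8 statements merged into one kernel-verified Lean document; each statement's English description precedes it below -/
import Mathlib

section
/- Suppose Assumption 2 holds. Then for every set M ⊆ E of pairwise disjoint matches with ⋃_{e∈M} R(e) ≠ R, there exists a match e' ∈ E that is disjoint from every match of M and whose rider set contains a rider not in ⋃_{e∈M} R(e). Consequently, every set of pairwise disjoint matches of E that is maximal with respect to adding a further match of E disjoint from all its members is a feasible solution, i.e., its rider sets cover all of R. (This is the feasibility of Algorithm GreedyMinDist, Lemma 3 of the paper.) -/
open Finset

/-- Two matches are disjoint: distinct drivers and disjoint rider sets. -/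
def MDisj {V : Type*} (e f : V × Finset V) : Prop :=
  e.1 ≠ f.1 ∧ Disjoint e.2 f.2

/-- A family of nonempty pairwise disjoint finite sets has at most as many members as its union
has elements. -/
theorem card_le_card_biUnion_of_MDisj {V : Type*} [DecidableEq V] {M : Finset (V × Finset V)}
    (hne : ∀ e ∈ M, e.2.Nonempty) (hdisj : ∀ e ∈ M, ∀ f ∈ M, e ≠ f → MDisj e f) :
    M.card ≤ (M.biUnion Prod.snd).card :=
  Finset.card_le_card_biUnion (fun e he f hf hef => (hdisj e he f hf hef).2) hne

/-- Feasibility of Algorithm GreedyMinDist (Lemma 3): under Assumption 2, any set of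
pairwise disjoint matches not covering all riders can be extended by a further disjoint
match covering a new rider; consequently any maximal set of pairwise disjoint matches
covers all of `R`. -/
theorem greedyMinDist_feasible {V : Type*} [DecidableEq V]
    (D R : Finset V) (lam : ℕ) (hDR : Disjoint D R)
    (E : Finset (V × Finset V))
    (hE : ∀ e ∈ E, e.1 ∈ D ∧ e.2 ⊆ R ∧ e.2.Nonempty ∧ e.2.card ≤ lam)
    -- Assumption 2
    (hA2 : ∃ Δ ⊆ D, Δ.card = R.card ∧ ∀ η ∈ Δ, ∀ r ∈ R, (η, ({r} : Finset V)) ∈ E) :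
    (∀ M ⊆ E, (∀ e ∈ M, ∀ f ∈ M, e ≠ f → MDisj e f) →
      M.biUnion Prod.snd ≠ R →
      ∃ e' ∈ E, (∀ e ∈ M, MDisj e' e) ∧ ∃ r ∈ e'.2, r ∉ M.biUnion Prod.snd)
    ∧
    (∀ M ⊆ E, (∀ e ∈ M, ∀ f ∈ M, e ≠ f → MDisj e f) →
      (∀ e' ∈ E, (∀ e ∈ M, MDisj e' e) → e' ∈ M) →
      M.biUnion Prod.snd = R) := by
  have extend : ∀ M ⊆ E, (∀ e ∈ M, ∀ f ∈ M, e ≠ f → MDisj e f) →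
      M.biUnion Prod.snd ≠ R →
      ∃ e' ∈ E, (∀ e ∈ M, MDisj e' e) ∧ ∃ r ∈ e'.2, r ∉ M.biUnion Prod.snd := by
    intro M hM hdisj hne
    obtain ⟨Δ, -, hcard, hΔ⟩ := hA2
    have hsub : M.biUnion Prod.snd ⊂ R :=
      (Finset.biUnion_subset.2 fun e he => (hE e (hM he)).2.1).ssubset_of_ne hne
    obtain ⟨r, hr, hrM⟩ := Finset.exists_of_ssubset hsub
    have hlt : (M.image Prod.fst).card < Δ.card := by
      rw [hcard]
      exact (Finset.card_image_le.trans (card_le_card_biUnion_of_MDisj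
        (fun e he => (hE e (hM he)).2.2.1) hdisj)).trans_lt (Finset.card_lt_card hsub)
    obtain ⟨η, hη, hηM⟩ := Finset.exists_mem_notMem_of_card_lt_card hlt
    refine ⟨(η, {r}), hΔ η hη r hr, fun e he => ⟨?_, ?_⟩, r, Finset.mem_singleton_self r, hrM⟩
    · rintro rfl
      exact hηM (Finset.mem_image_of_mem _ he)
    · exact Finset.disjoint_singleton_left.2 fun h => hrM (Finset.mem_biUnion.2 ⟨e, he, h⟩)
  refine ⟨extend, fun M hM hdisj hmax => ?_⟩
  by_contra hne
  obtain ⟨e', he', hd, r, hr, hrM⟩ := extend M hM hdisj hne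
  exact hrM (Finset.mem_biUnion.2 ⟨e', hmax e' he' hd, hr⟩)
end

section
/- Suppose Assumption 2 holds, E is downward closed, and weights are monotone. Let M₁ be a greedy min-weight solution. Then there exists a feasible solution M' such that |R(e')| = 1 for every e' ∈ M' and w(M') ≥ w(M₁), and moreover M' can be ordered e'_1,…,e'_m so that each e'_i has minimum weight among all matches of E with singleton rider set that are disjoint from e'_1,…,e'_{i-1}. (Lemma 4 of the paper.) -/
open Finset

/-- A feasible solution given as an ordered list: all matches belong to `E`, they are
pairwise disjoint, and their rider sets cover all of `R`. -/
def FeasList {V : Type*} [DecidableEq V] (E : Finset (V × Finset V)) (R : Finset V)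
    (L : List (V × Finset V)) : Prop :=
  (∀ e ∈ L, e ∈ E) ∧ L.Pairwise MDisj ∧ L.foldr (fun e s => e.2 ∪ s) ∅ = R

/-- A greedy min-weight solution: a feasible solution ordered so that each match has
minimum weight among all matches of `E` disjoint from all earlier ones. -/
def GreedyMinW {V : Type*} [DecidableEq V] (E : Finset (V × Finset V)) (R : Finset V)
    (w : V × Finset V → ℕ) (L : List (V × Finset V)) : Prop :=
  FeasList E R L ∧
  ∀ i : Fin L.length, ∀ f ∈ E,
    (∀ j : Fin L.length, (j : ℕ) < (i : ℕ) → MDisj f (L.get j)) →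
    w (L.get i) ≤ w f

/-- A feasible solution all of whose matches have singleton rider sets, ordered so that
each match has minimum weight among all matches of `E` with singleton rider set disjoint
from all earlier ones. -/
def GreedySingW {V : Type*} [DecidableEq V] (E : Finset (V × Finset V)) (R : Finset V)
    (w : V × Finset V → ℕ) (L : List (V × Finset V)) : Prop :=
  FeasList E R L ∧ (∀ e ∈ L, e.2.card = 1) ∧
  ∀ i : Fin L.length, ∀ f ∈ E, f.2.card = 1 →
    (∀ j : Fin L.length, (j : ℕ) < (i : ℕ) → MDisj f (L.get j)) →
    w (L.get i) ≤ w f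

theorem MDisj.symm {V : Type*} {e f : V × Finset V} (h : MDisj e f) : MDisj f e :=
  ⟨h.1.symm, h.2.symm⟩

/-- `f` is a match of `E` with a single rider that is disjoint from every match of `P`. -/
def SingAvail {V : Type*} (E : Finset (V × Finset V)) (P : List (V × Finset V))
    (f : V × Finset V) : Prop :=
  f ∈ E ∧ f.2.card = 1 ∧ ∀ p ∈ P, MDisj f p

theorem SingAvail.of_append {V : Type*} {E : Finset (V × Finset V)}
    {P Q : List (V × Finset V)} {f : V × Finset V} (h : SingAvail E (P ++ Q) f) :
    SingAvail E P f :=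
  ⟨h.1, h.2.1, fun p hp => h.2.2 p (List.mem_append_left _ hp)⟩

/-- Lists built by repeatedly appending a cheapest available single-rider match. -/
inductive SingRun {V : Type*} (E : Finset (V × Finset V)) (w : V × Finset V → ℕ) :
    List (V × Finset V) → Prop
  | nil : SingRun E w []
  | snoc (P : List (V × Finset V)) (e : V × Finset V) (hP : SingRun E w P)
      (he : SingAvail E P e) (hmin : ∀ f, SingAvail E P f → w e ≤ w f) :
      SingRun E w (P ++ [e])

namespace SingRun

variable {V : Type*} {E : Finset (V × Finset V)} {w : V × Finset V → ℕ}
  {P : List (V × Finset V)}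

theorem mem (h : SingRun E w P) : ∀ e ∈ P, e ∈ E ∧ e.2.card = 1 := by
  induction h with
  | nil => simp
  | snoc P e hP he hmin ih =>
    intro f hf
    rcases List.mem_append.1 hf with hf | hf
    · exact ih f hf
    · rw [List.mem_singleton.1 hf]
      exact ⟨he.1, he.2.1⟩

theorem pairwise (h : SingRun E w P) : P.Pairwise MDisj := by
  induction h with
  | nil => simp
  | snoc P e hP he hmin ih =>
    refine List.pairwise_append.2 ⟨ih, List.pairwise_singleton _ _, fun a ha b hb => ?_⟩
    rw [List.mem_singleton.1 hb]
    exact (he.2.2 a ha).symm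

theorem getElem_le (h : SingRun E w P) : ∀ i (hi : i < P.length) (f : V × Finset V),
    f ∈ E → f.2.card = 1 → (∀ j (hj : j < P.length), j < i → MDisj f P[j]) →
    w P[i] ≤ w f := by
  induction h with
  | nil => simp
  | snoc P e hP he hmin ih =>
    intro i hi f hf hc hd
    have hd' : ∀ j (hj : j < P.length), j < i → MDisj f P[j] := by
      intro j hj hji
      have := hd j (by simp; omega) hji
      rwa [List.getElem_append_left hj] at this
    by_cases hiP : i < P.length
    · rw [List.getElem_append_left hiP]
      exact ih i hiP f hf hc hd'
    · have hi' : i = P.length := by simp at hi; omega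
      subst hi'
      rw [List.getElem_concat_length rfl]
      refine hmin f ⟨hf, hc, fun p hp => ?_⟩
      obtain ⟨j, hj, rfl⟩ := List.mem_iff_getElem.1 hp
      exact hd' j hj hj

end SingRun

/-- The run `P` of single-rider matches keeps pace with the matches in `T`: it uses all their
drivers and only their riders, and serves the riders of each `e ∈ T` at weight at least `w e`. -/
structure Tracks {V : Type*} (E : Finset (V × Finset V)) (w : V × Finset V → ℕ)
    (P T : List (V × Finset V)) : Prop where
  run : SingRun E w P
  driver : ∀ e ∈ T, ∃ p ∈ P, p.1 = e.1
  rider : ∀ p ∈ P, ∃ e ∈ T, p.2 ⊆ e.2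
  le_of_mem : ∀ e ∈ T, ∀ p ∈ P, p.2 ⊆ e.2 → w e ≤ w p
  le_of_avail : ∀ e ∈ T, ∀ f, SingAvail E P f → w e ≤ w f

namespace Tracks

variable {V : Type*} {E : Finset (V × Finset V)} {w : V × Finset V → ℕ}
  {P T : List (V × Finset V)}

theorem snoc (h : Tracks E w P T) {g : V × Finset V} (hg : SingAvail E P g)
    (hmin : ∀ f, SingAvail E P f → w g ≤ w f) (hr : ∃ e ∈ T, g.2 ⊆ e.2) :
    Tracks E w (P ++ [g]) T where
  run := .snoc P g h.run hg hmin
  driver e he := by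
    obtain ⟨p, hp, hpe⟩ := h.driver e he
    exact ⟨p, List.mem_append_left _ hp, hpe⟩
  rider p hp := by
    rcases List.mem_append.1 hp with hp | hp
    · exact h.rider p hp
    · rwa [List.mem_singleton.1 hp]
  le_of_mem e he p hp hpe := by
    rcases List.mem_append.1 hp with hp | hp
    · exact h.le_of_mem e he p hp hpe
    · rw [List.mem_singleton.1 hp]
      exact h.le_of_avail e he g hg
  le_of_avail e he f hf := h.le_of_avail e he f hf.of_append

/-- If every match of weight less than `v` meets `T`, then the run can be continued until no
single-rider match of weight less than `v` is available. -/
theorem exists_saturated (v : ℕ) (hv : ∀ f ∈ E, (∀ e ∈ T, MDisj f e) → v ≤ w f)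
    (h : Tracks E w P T) :
    ∃ Q, Tracks E w Q T ∧ ∀ f, SingAvail E Q f → v ≤ w f := by
  classical
  induction hn : (E.filter (SingAvail E P)).card using Nat.strong_induction_on
    generalizing P with
  | _ n ih =>
  by_cases hs : ∀ f, SingAvail E P f → v ≤ w f
  · exact ⟨P, h, hs⟩
  push Not at hs
  obtain ⟨f₀, hf₀, hlt₀⟩ := hs
  obtain ⟨g, hg, hmin⟩ := (E.filter (SingAvail E P)).exists_min_image w
    ⟨f₀, Finset.mem_filter.2 ⟨hf₀.1, hf₀⟩⟩
  replace hmin : ∀ f, SingAvail E P f → w g ≤ w f :=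
    fun f hf => hmin f (Finset.mem_filter.2 ⟨hf.1, hf⟩)
  have hgE := (Finset.mem_filter.1 hg).2
  have hr : ∃ e ∈ T, g.2 ⊆ e.2 := by
    by_contra! hcon
    refine absurd (hv g hgE.1 fun e he => ⟨?_, ?_⟩) (not_le.2 ((hmin f₀ hf₀).trans_lt hlt₀))
    · obtain ⟨p, hp, hpe⟩ := h.driver e he
      exact hpe ▸ (hgE.2.2 p hp).1
    · have hce := hcon e he
      obtain ⟨r, hr⟩ := Finset.card_eq_one.1 hgE.2.1
      rw [hr] at hce ⊢
      simpa using hce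
  refine ih _ ?_ (h.snoc hgE hmin hr) rfl
  rw [← hn]
  refine Finset.card_lt_card ((Finset.ssubset_iff_of_subset ?_).2 ⟨g, hg, fun hg' => ?_⟩)
  · intro f hf
    rw [Finset.mem_filter] at hf ⊢
    exact ⟨hf.1, hf.2.of_append⟩
  · exact ((Finset.mem_filter.1 hg').2.2.2 g (by simp)).1 rfl

/-- If a saturated run tracks `T`, it can be made to track one more match. -/
theorem exists_snoc
    (hDC : ∀ η : V, ∀ S : Finset V, (η, S) ∈ E → ∀ S' ⊆ S, S'.Nonempty → (η, S') ∈ E)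
    (hMono : ∀ η : V, ∀ S S' : Finset V, (η, S) ∈ E → (η, S') ∈ E → S' ⊆ S →
      w (η, S') ≤ w (η, S))
    {e : V × Finset V} (heE : e ∈ E) (hne : e.2.Nonempty)
    (hd : ∀ a ∈ T, MDisj a e) (h : Tracks E w P T)
    (hs : ∀ f, SingAvail E P f → w e ≤ w f) :
    ∃ Q, Tracks E w Q (T ++ [e]) := by
  have hPe : ∀ p ∈ P, Disjoint p.2 e.2 := by
    intro p hp
    obtain ⟨a, ha, hpa⟩ := h.rider p hp
    exact Finset.disjoint_of_subset_left hpa (hd a ha).2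
  have hPn : ∀ p ∈ P, ¬ p.2 ⊆ e.2 := by
    intro p hp hpe
    have h0 : p.2 = ∅ := by
      simpa using Finset.disjoint_of_subset_right hpe (hPe p hp)
    have h1 := (h.run.mem p hp).2
    simp [h0] at h1
  by_cases hdr : ∃ p ∈ P, p.1 = e.1
  · refine ⟨P, h.run, ?_, ?_, ?_, ?_⟩
    · intro a ha
      rcases List.mem_append.1 ha with ha | ha
      · exact h.driver a ha
      · rwa [List.mem_singleton.1 ha]
    · intro p hp
      obtain ⟨a, ha, hpa⟩ := h.rider p hp
      exact ⟨a, List.mem_append_left _ ha, hpa⟩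
    · intro a ha p hp hpa
      rcases List.mem_append.1 ha with ha | ha
      · exact h.le_of_mem a ha p hp hpa
      · rw [List.mem_singleton.1 ha] at hpa
        exact absurd hpa (hPn p hp)
    · intro a ha f hf
      rcases List.mem_append.1 ha with ha | ha
      · exact h.le_of_avail a ha f hf
      · rw [List.mem_singleton.1 ha]
        exact hs f hf
  · push Not at hdr
    obtain ⟨r, hr⟩ := hne
    have hsub : ({r} : Finset V) ⊆ e.2 := Finset.singleton_subset_iff.2 hr
    have hgE : (e.1, ({r} : Finset V)) ∈ E := hDC e.1 e.2 heE _ hsub ⟨r, by simp⟩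
    have hg : SingAvail E P (e.1, {r}) := by
      refine ⟨hgE, by simp, fun p hp => ⟨fun hpe => hdr p hp hpe.symm, ?_⟩⟩
      exact Finset.disjoint_of_subset_left hsub (hPe p hp).symm
    have hle : w (e.1, {r}) ≤ w e := hMono e.1 e.2 {r} heE hgE hsub
    refine ⟨P ++ [(e.1, {r})], .snoc P _ h.run hg fun f hf => hle.trans (hs f hf),
      ?_, ?_, ?_, ?_⟩
    · intro a ha
      rcases List.mem_append.1 ha with ha | ha
      · obtain ⟨p, hp, hpa⟩ := h.driver a ha
        exact ⟨p, List.mem_append_left _ hp, hpa⟩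
      · rw [List.mem_singleton.1 ha]
        exact ⟨(e.1, {r}), by simp, rfl⟩
    · intro p hp
      rcases List.mem_append.1 hp with hp | hp
      · obtain ⟨a, ha, hpa⟩ := h.rider p hp
        exact ⟨a, List.mem_append_left _ ha, hpa⟩
      · rw [List.mem_singleton.1 hp]
        exact ⟨e, by simp, hsub⟩
    · intro a ha p hp hpa
      rcases List.mem_append.1 hp with hp | hp <;> rcases List.mem_append.1 ha with ha | ha
      · exact h.le_of_mem a ha p hp hpa
      · rw [List.mem_singleton.1 ha] at hpa
        exact absurd hpa (hPn p hp)
      · rw [List.mem_singleton.1 hp]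
        exact h.le_of_avail a ha _ hg
      · rw [List.mem_singleton.1 hp, List.mem_singleton.1 ha]
        exact hs _ hg
    · intro a ha f hf
      rcases List.mem_append.1 ha with ha | ha
      · exact h.le_of_avail a ha f hf.of_append
      · rw [List.mem_singleton.1 ha]
        exact hs f hf.of_append

end Tracks

theorem mem_foldr_union {V : Type*} [DecidableEq V] (L : List (V × Finset V)) (r : V) :
    r ∈ L.foldr (fun e s => e.2 ∪ s) ∅ ↔ ∃ e ∈ L, r ∈ e.2 := by
  induction L with
  | nil => simp
  | cons a L ih => simp [ih]

theorem nodup_of_pairwise_mDisj {V : Type*} {L : List (V × Finset V)}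
    (h : L.Pairwise MDisj) : L.Nodup :=
  h.imp fun hab hEq => hab.1 (congrArg Prod.fst hEq)

theorem mDisj_of_mem_of_ne {V : Type*} {L : List (V × Finset V)} (h : L.Pairwise MDisj)
    {a b : V × Finset V} (ha : a ∈ L) (hb : b ∈ L) (hab : a ≠ b) : MDisj a b :=
  have : Std.Symm (MDisj (V := V)) := ⟨fun _ _ => MDisj.symm⟩
  h.forall ha hb hab

/-- A single-rider run that cannot be continued serves every rider. -/
theorem SingRun.exists_rider {V : Type*} [DecidableEq V] {E : Finset (V × Finset V)}
    {w : V × Finset V → ℕ} {P : List (V × Finset V)} {R Δ : Finset V}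
    (hER : ∀ e ∈ E, e.2 ⊆ R) (hcard : Δ.card = R.card)
    (hΔ : ∀ η ∈ Δ, ∀ r ∈ R, (η, ({r} : Finset V)) ∈ E)
    (h : SingRun E w P) (hmax : ∀ f, ¬ SingAvail E P f) {r : V} (hr : r ∈ R) :
    ∃ p ∈ P, p.2 = {r} := by
  by_contra! hcon
  have hnot : ∀ p ∈ P, r ∉ p.2 := by
    intro p hp hrp
    obtain ⟨x, hx⟩ := Finset.card_eq_one.1 (h.mem p hp).2
    rw [hx, Finset.mem_singleton] at hrp
    exact hcon p hp (hrp ▸ hx)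
  have hU : (P.toFinset.biUnion Prod.snd).card = P.toFinset.card := by
    rw [Finset.card_biUnion, Finset.card_eq_sum_ones]
    · exact Finset.sum_congr rfl fun p hp => (h.mem p (List.mem_toFinset.1 hp)).2
    · intro a ha b hb hab
      exact (mDisj_of_mem_of_ne h.pairwise (List.mem_toFinset.1 ha)
        (List.mem_toFinset.1 hb) hab).2
  have hlt : (P.toFinset.biUnion Prod.snd).card < R.card := by
    refine Finset.card_lt_card ((Finset.ssubset_iff_of_subset ?_).2 ⟨r, hr, ?_⟩)
    · exact Finset.biUnion_subset.2 fun p hp => hER p (h.mem p (List.mem_toFinset.1 hp)).1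
    · simpa using fun a b hp => hnot (a, b) hp
  have hlt' : (P.toFinset.image Prod.fst).card < Δ.card := by
    have := Finset.card_image_le (s := P.toFinset) (f := Prod.fst)
    omega
  obtain ⟨η, hη, hηP⟩ := Finset.exists_mem_notMem_of_card_lt_card hlt'
  refine hmax (η, {r}) ⟨hΔ η hη r hr, by simp, fun p hp => ⟨?_, ?_⟩⟩
  · rintro rfl
    exact hηP (Finset.mem_image_of_mem _ (List.mem_toFinset.2 hp))
  · simpa using hnot p hp

/-- If every match of `L` contains the riders of some match of `P` that is at least as
expensive, then `P` weighs at least as much as `L`. -/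
theorem sum_map_le_of_dominated {V : Type*} [DecidableEq V] {w : V × Finset V → ℕ}
    {L P : List (V × Finset V)} (hL : L.Pairwise MDisj) (hP : P.Pairwise MDisj)
    (h : ∀ e ∈ L, ∃ p ∈ P, p.2.Nonempty ∧ p.2 ⊆ e.2 ∧ w e ≤ w p) :
    (L.map w).sum ≤ (P.map w).sum := by
  choose! g hgP hgne hgsub hgw using h
  rw [← List.sum_toFinset w (nodup_of_pairwise_mDisj hL),
    ← List.sum_toFinset w (nodup_of_pairwise_mDisj hP)]
  have hinj : Set.InjOn g (L.toFinset : Set (V × Finset V)) := by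
    intro a ha b hb hab
    have ha' : a ∈ L := by simpa using ha
    have hb' : b ∈ L := by simpa using hb
    by_contra hne
    obtain ⟨r, hr⟩ := hgne a ha'
    exact Finset.disjoint_left.1 (mDisj_of_mem_of_ne hL ha' hb' hne).2
      (hgsub a ha' hr) (hgsub b hb' (hab ▸ hr))
  calc ∑ e ∈ L.toFinset, w e ≤ ∑ e ∈ L.toFinset, w (g e) :=
        Finset.sum_le_sum fun e he => hgw e (List.mem_toFinset.1 he)
    _ = ∑ p ∈ L.toFinset.image g, w p := (Finset.sum_image hinj).symm
    _ ≤ ∑ p ∈ P.toFinset, w p := by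
        refine Finset.sum_le_sum_of_subset (Finset.image_subset_iff.2 fun e he => ?_)
        exact List.mem_toFinset.2 (hgP e (List.mem_toFinset.1 he))

theorem GreedyMinW.le_of_eq_append {V : Type*} [DecidableEq V] {E : Finset (V × Finset V)}
    {R : Finset V} {w : V × Finset V → ℕ} {L T S : List (V × Finset V)} {e : V × Finset V}
    (hL : GreedyMinW E R w L) (hTS : L = T ++ e :: S) {f : V × Finset V} (hf : f ∈ E)
    (hd : ∀ a ∈ T, MDisj f a) : w e ≤ w f := by
  subst hTS
  have := hL.2 ⟨T.length, by simp⟩ f hf fun j hj => by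
    have hj' : (j : ℕ) < T.length := hj
    rw [List.get_eq_getElem, List.getElem_append_left hj']
    exact hd _ (List.getElem_mem _)
  simpa using this

/-- Lemma 4: from a greedy min-weight solution `M₁` one can construct a feasible solution
`M'` consisting only of singleton-rider matches, of weight at least `w(M₁)`, which is a
greedy solution restricted to singleton-rider matches. -/
theorem greedyMinDist_extreme_solution {V : Type*} [DecidableEq V]
    (D R : Finset V) (lam : ℕ) (hDR : Disjoint D R)
    (E : Finset (V × Finset V))
    (hE : ∀ e ∈ E, e.1 ∈ D ∧ e.2 ⊆ R ∧ e.2.Nonempty ∧ e.2.card ≤ lam)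
    -- Assumption 2
    (hA2 : ∃ Δ ⊆ D, Δ.card = R.card ∧ ∀ η ∈ Δ, ∀ r ∈ R, (η, ({r} : Finset V)) ∈ E)
    -- E is downward closed
    (hDC : ∀ η : V, ∀ S : Finset V, (η, S) ∈ E →
      ∀ S' ⊆ S, S'.Nonempty → (η, S') ∈ E)
    (w : V × Finset V → ℕ) (hw : ∀ e ∈ E, 1 ≤ w e)
    -- weights are monotone
    (hMono : ∀ η : V, ∀ S S' : Finset V, (η, S) ∈ E → (η, S') ∈ E → S' ⊆ S →
      w (η, S') ≤ w (η, S))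
    (L₁ : List (V × Finset V)) (hL₁ : GreedyMinW E R w L₁) :
    ∃ L' : List (V × Finset V), GreedySingW E R w L' ∧
      (L₁.map w).sum ≤ (L'.map w).sum := by
  obtain ⟨Δ, -, hcard, hΔ⟩ := hA2
  obtain ⟨hLE, hLd, hLR⟩ := hL₁.1
  have htrack : ∀ T S, L₁ = T ++ S → ∃ P, Tracks E w P T := by
    intro T
    induction T using List.reverseRecOn with
    | nil => exact fun _ _ => ⟨[], .nil, by simp, by simp, by simp, by simp⟩
    | append_singleton T e ih =>
      intro S hS
      have hS' : L₁ = T ++ e :: S := by simpa using hS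
      obtain ⟨P, hP⟩ := ih _ hS'
      obtain ⟨Q, hQ, hsat⟩ := hP.exists_saturated (w e)
        fun f hf hd => hL₁.le_of_eq_append hS' hf hd
      have he : e ∈ L₁ := by simp [hS']
      refine hQ.exists_snoc hDC hMono (hLE e he) (hE e (hLE e he)).2.2.1 (fun a ha => ?_) hsat
      rw [hS'] at hLd
      exact (List.pairwise_append.1 hLd).2.2 a ha e (by simp)
  obtain ⟨P, hP⟩ := htrack L₁ [] (by simp)
  obtain ⟨Q, hQ, hsat⟩ := hP.exists_saturated (E.sup w + 1) fun f hf hd => by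
    obtain ⟨r, hr⟩ := (hE f hf).2.2.1
    have hrR := (hE f hf).2.1 hr
    rw [← hLR, mem_foldr_union] at hrR
    obtain ⟨e, he, hre⟩ := hrR
    exact absurd hre (Finset.disjoint_left.1 (hd e he).2 hr)
  have hmax : ∀ f, ¬ SingAvail E Q f := fun f hf => by
    have h1 := hsat f hf
    have h2 := Finset.le_sup (f := w) hf.1
    omega
  have hcov : ∀ r ∈ R, ∃ p ∈ Q, p.2 = {r} := fun r hr =>
    hQ.run.exists_rider (fun e he => (hE e he).2.1) hcard hΔ hmax hr
  refine ⟨Q, ⟨⟨fun e he => (hQ.run.mem e he).1, hQ.run.pairwise, ?_⟩,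
    fun e he => (hQ.run.mem e he).2, fun i f hf hc hd => ?_⟩, ?_⟩
  · ext r
    rw [mem_foldr_union]
    constructor
    · rintro ⟨p, hp, hr⟩
      exact (hE p (hQ.run.mem p hp).1).2.1 hr
    · intro hr
      obtain ⟨p, hp, hpr⟩ := hcov r hr
      exact ⟨p, hp, by simp [hpr]⟩
  · exact hQ.run.getElem_le i i.2 f hf hc fun j hj hji => hd ⟨j, hj⟩ hji
  · refine sum_map_le_of_dominated hLd hQ.run.pairwise fun e he => ?_
    obtain ⟨r, hr⟩ := (hE e (hLE e he)).2.2.1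
    obtain ⟨p, hp, hpr⟩ := hcov r ((hE e (hLE e he)).2.1 hr)
    have hsub : p.2 ⊆ e.2 := by simpa [hpr] using hr
    exact ⟨p, hp, by simp [hpr], hsub, hQ.le_of_mem e he p hp hsub⟩
end

section
/- Suppose E is downward closed and weights are monotone. Let M₁ be a feasible solution all of whose matches have singleton rider sets and which can be ordered e_1,…,e_m so that each e_i has minimum weight among all matches of E with singleton rider set that are disjoint from e_1,…,e_{i-1}. Let e* ∈ E be a match with D(e*) ∈ D(M₁), and suppose the (unique) match e ∈ M₁ with D(e) = D(e*) satisfies w(e) > w(e*). Then for every rider r ∈ R(e*), the match of M₁ whose rider set is {r} has weight at most w(e*). (Key intermediate claim in the proof of Lemma 5 of the paper.) -/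
open Finset

/-- Key intermediate claim in the proof of Lemma 5: if `e*` is a match of `E` whose
driver is used by the greedy singleton solution `M₁` via a match `e` with `w(e) > w(e*)`,
then for every rider `r` of `e*`, the match of `M₁` covering `r` has weight at most
`w(e*)`. -/
theorem greedySing_cover_weight {V : Type*} [DecidableEq V]
    (D R : Finset V) (lam : ℕ) (hDR : Disjoint D R)
    (E : Finset (V × Finset V))
    (hE : ∀ e ∈ E, e.1 ∈ D ∧ e.2 ⊆ R ∧ e.2.Nonempty ∧ e.2.card ≤ lam)
    -- E is downward closed
    (hDC : ∀ η : V, ∀ S : Finset V, (η, S) ∈ E →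
      ∀ S' ⊆ S, S'.Nonempty → (η, S') ∈ E)
    (w : V × Finset V → ℕ) (hw : ∀ e ∈ E, 1 ≤ w e)
    -- weights are monotone
    (hMono : ∀ η : V, ∀ S S' : Finset V, (η, S) ∈ E → (η, S') ∈ E → S' ⊆ S →
      w (η, S') ≤ w (η, S))
    (L₁ : List (V × Finset V)) (hL₁ : GreedySingW E R w L₁)
    (estar : V × Finset V) (hestar : estar ∈ E)
    (e : V × Finset V) (he : e ∈ L₁) (heD : e.1 = estar.1)
    (hgt : w estar < w e) :
    ∀ r ∈ estar.2, ∀ e' ∈ L₁, e'.2 = {r} → w e' ≤ w estar := by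
  intro r hr e' he' hr'
  obtain ⟨⟨-, hpw, -⟩, -, hgreedy⟩ := hL₁
  obtain ⟨k, rfl⟩ := List.mem_iff_get.mp he
  obtain ⟨i, rfl⟩ := List.mem_iff_get.mp he'
  have hsub : {r} ⊆ estar.2 := Finset.singleton_subset_iff.mpr hr
  have hf : (estar.1, {r}) ∈ E := hDC _ _ hestar _ hsub (Finset.singleton_nonempty r)
  have hle : w (estar.1, {r}) ≤ w estar := hMono _ _ _ hestar hf hsub
  have hpair : ∀ a b : Fin L₁.length, a < b → MDisj (L₁.get a) (L₁.get b) :=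
    fun a b hab => List.pairwise_iff_get.mp hpw a b hab
  have hdisj : ∀ j : Fin L₁.length, j < i → j < k → MDisj (estar.1, {r}) (L₁.get j) := by
    intro j hji hjk
    refine ⟨?_, ?_⟩
    · rw [← heD]
      exact (hpair j k hjk).1.symm
    · rw [← hr']
      exact (hpair j i hji).2.symm
  rcases le_or_gt i k with hik | hki
  · exact (hgreedy i _ hf (Finset.card_singleton r)
      fun j hj => hdisj j hj (lt_of_lt_of_le hj hik)).trans hle
  · have hkle := hgreedy k _ hf (Finset.card_singleton r)
      fun j hj => hdisj j (lt_trans hj hki) hj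
    exact absurd hgt (hkle.trans hle).not_gt
end

section
/- Suppose Assumption 2 holds, E is downward closed, weights are monotone, and λ ≥ 2. Let μ = (max_{e∈E} w(e)) / (min_{e∈E} w(e)). Let M be a greedy min-weight solution and let M* be a feasible solution of minimum total weight. Then w(M) ≤ ((λ²·μ + λ)/(λ + 1)) · w(M*). (Theorem 3 of the paper: Algorithm GreedyMinDist is a (λ²μ+λ)/(λ+1)-approximation for MTRS-minDist.) -/
open Finset

/-- A feasible solution given as a set of matches. -/
def FeasSet {V : Type*} [DecidableEq V] (E : Finset (V × Finset V)) (R : Finset V)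
    (M : Finset (V × Finset V)) : Prop :=
  M ⊆ E ∧ (∀ e ∈ M, ∀ f ∈ M, e ≠ f → MDisj e f) ∧ M.biUnion Prod.snd = R

/-- In a greedy sequence, a match `m` whose driver is unused before step `i` and which still has
a rider not served before step `i` weighs at least as much as the match chosen at step `i`. -/
lemma greedy_weight_le_of_alive {V : Type*} [DecidableEq V] {n : ℕ}
    {E : Finset (V × Finset V)} {w : V × Finset V → ℕ} {g : Fin n → V × Finset V}
    (hDC : ∀ η : V, ∀ S : Finset V, (η, S) ∈ E → ∀ S' ⊆ S, S'.Nonempty → (η, S') ∈ E)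
    (hMono : ∀ η : V, ∀ S S' : Finset V, (η, S) ∈ E → (η, S') ∈ E → S' ⊆ S →
      w (η, S') ≤ w (η, S))
    (hgreedy : ∀ i, ∀ f ∈ E, (∀ j < i, MDisj f (g j)) → w (g i) ≤ w f)
    {m : V × Finset V} (hm : m ∈ E) {i : Fin n} (hdriver : ∀ j < i, m.1 ≠ (g j).1)
    {r : V} (hr : r ∈ m.2) (hrider : ∀ j < i, r ∉ (g j).2) :
    w (g i) ≤ w m := by
  have hsub : ({r} : Finset V) ⊆ m.2 := by simpa using hr
  have hmem : (m.1, ({r} : Finset V)) ∈ E := hDC m.1 m.2 hm _ hsub (singleton_nonempty r)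
  refine (hgreedy i _ hmem fun j hj => ⟨hdriver j hj, ?_⟩).trans (hMono m.1 m.2 _ hm hmem hsub)
  simpa using hrider j hj

/-- The arithmetic of the approximation factor `K` with extreme weights `p ≤ q`. -/
lemma approx_factor_bounds {l p q K : ℝ} (hl : 1 ≤ l) (hp : 0 < p) (hpq : p ≤ q)
    (hK : K = (l ^ 2 * (q / p) + l) / (l + 1)) :
    1 ≤ K / l ∧ (l - 1) * q ≤ (K - 1) * p ∧ K / l * p + (K - 1) * p = l * q := by
  have hl0 : 0 < l := by linarith
  have hKl : K / l = (l * q + p) / ((l + 1) * p) := by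
    rw [hK]; field_simp
  have hKp : K * p = (l ^ 2 * q + l * p) / (l + 1) := by
    rw [hK]; field_simp
  refine ⟨?_, ?_, ?_⟩
  · rw [hKl, one_le_div (by positivity)]
    nlinarith
  · rw [sub_mul K, hKp, le_sub_iff_add_le, le_div_iff₀ (by positivity)]
    nlinarith
  · rw [sub_mul K, hKp, hKl]
    field_simp
    ring

/-- Pairwise disjoint sets meet a given set in at most as many elements as it has. -/
lemma sum_card_inter_le_card {ι V : Type*} [Fintype ι] [DecidableEq V] {S : ι → Finset V}
    (hS : ∀ i j, i ≠ j → Disjoint (S i) (S j)) (T : Finset V) :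
    ∑ i, (S i ∩ T).card ≤ T.card := by
  rw [← card_biUnion fun i _ j _ hij =>
    (hS i j hij).mono inter_subset_left inter_subset_left]
  exact card_le_card (biUnion_subset.2 fun i _ => inter_subset_right)

/-- The approximation bound for a greedy sequence `g` against a family `N` of pairwise disjoint
matches that covers all riders. -/
lemma greedy_sum_le_factor_mul {V : Type*} [DecidableEq V] {n : ℕ} {R : Finset V}
    {E N : Finset (V × Finset V)} {w : V × Finset V → ℕ} {g : Fin n → V × Finset V} {lam : ℕ}
    (hlam : 1 ≤ lam) (hE : ∀ e ∈ E, e.2 ⊆ R ∧ e.2.Nonempty ∧ e.2.card ≤ lam)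
    (hDC : ∀ η : V, ∀ S : Finset V, (η, S) ∈ E → ∀ S' ⊆ S, S'.Nonempty → (η, S') ∈ E)
    (hMono : ∀ η : V, ∀ S S' : Finset V, (η, S) ∈ E → (η, S') ∈ E → S' ⊆ S →
      w (η, S') ≤ w (η, S))
    (hgE : ∀ i, g i ∈ E) (hgdisj : ∀ i j, i ≠ j → MDisj (g i) (g j))
    (hgreedy : ∀ i, ∀ f ∈ E, (∀ j < i, MDisj f (g j)) → w (g i) ≤ w f)
    (hN : FeasSet E R N) {p q K : ℝ} (hp : 0 < p) (hpq : p ≤ q)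
    (hpw : ∀ e ∈ E, p ≤ w e) (hwq : ∀ e ∈ E, (w e : ℝ) ≤ q)
    (hK : K = ((lam : ℝ) ^ 2 * (q / p) + lam) / (lam + 1)) :
    ∑ i, (w (g i) : ℝ) ≤ K * ∑ e ∈ N, (w e : ℝ) := by
  classical
  obtain ⟨hNE, hNdisj, hNcov⟩ := hN
  have hlam' : (1 : ℝ) ≤ lam := by exact_mod_cast hlam
  have hlam0 : (0 : ℝ) < lam := by linarith
  obtain ⟨hK1, hK2, hK3⟩ := approx_factor_bounds hlam' hp hpq hK
  have hq : 0 ≤ q := hp.le.trans hpq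
  -- `A m`: the driver of `m` is taken while some rider of `m` is still unserved.
  let A : V × Finset V → Prop := fun m =>
    ∃ i, (g i).1 = m.1 ∧ ∃ r ∈ m.2, ∀ j < i, r ∉ (g j).2
  have driver_inj : ∀ i j, (g i).1 = (g j).1 → i = j := fun i j h => by
    by_contra hij
    exact (hgdisj i j hij).1 h
  have rider_inj : ∀ i j r, r ∈ (g i).2 → r ∈ (g j).2 → i = j := fun i j r hi hj => by
    by_contra hij
    exact disjoint_left.1 (hgdisj i j hij).2 hi hj
  have weight_le_of_A : ∀ m ∈ N, A m → ∀ i, (g i).1 = m.1 → (w (g i) : ℝ) ≤ w m := by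
    rintro m hm ⟨k, hk, r, hr, hrk⟩ i hi
    obtain rfl := driver_inj i k (hi.trans hk.symm)
    refine mod_cast greedy_weight_le_of_alive hDC hMono hgreedy (hNE hm) (fun j hj h => ?_) hr hrk
    exact hj.ne (driver_inj j i (h.symm.trans hi.symm))
  have weight_le_of_not_A : ∀ m ∈ N, ¬ A m → ∀ i, ∀ r ∈ (g i).2, r ∈ m.2 →
      (w (g i) : ℝ) ≤ w m := by
    intro m hm hA i r hri hrm
    have hfresh : ∀ j < i, r ∉ (g j).2 := fun j hj h => hj.ne (rider_inj j i r h hri)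
    refine mod_cast greedy_weight_le_of_alive hDC hMono hgreedy (hNE hm) (fun j hj h => hA ?_)
      hrm hfresh
    exact ⟨j, h.symm, r, hrm, fun k hk => hfresh k (hk.trans hj)⟩
  let c : V × Finset V → ℝ := fun m => if A m then q else K / lam * w m
  let b : Fin n → V × Finset V → ℝ := fun i m =>
    if A m ∧ (g i).1 = m.1 then K * w m - lam * q else 0
  have hc0 : ∀ m, 0 ≤ c m := fun m => by
    dsimp only [c]
    split_ifs
    · exact hq
    · exact mul_nonneg (by linarith) (Nat.cast_nonneg _)
  have charge : ∀ i, (w (g i) : ℝ) ≤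
      ∑ m ∈ N, (((g i).2 ∩ m.2).card * c m + b i m) := by
    intro i
    obtain ⟨hiR, ⟨r, hr⟩, -⟩ := hE _ (hgE i)
    have hrR := hiR hr
    rw [← hNcov, mem_biUnion] at hrR
    obtain ⟨m₁, hm₁, hrm₁⟩ := hrR
    have hc1 : c m₁ ≤ ∑ m ∈ N, (((g i).2 ∩ m.2).card * c m) := by
      have h1 : (1 : ℝ) ≤ ((g i).2 ∩ m₁.2).card := by
        exact_mod_cast card_pos.2 ⟨r, mem_inter.2 ⟨hr, hrm₁⟩⟩
      refine (le_mul_of_one_le_left (hc0 m₁) h1).trans ?_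
      exact single_le_sum (f := fun m => (((g i).2 ∩ m.2).card * c m : ℝ))
        (fun m _ => mul_nonneg (Nat.cast_nonneg _) (hc0 m)) hm₁
    rw [sum_add_distrib]
    by_cases h : ∃ m ∈ N, A m ∧ (g i).1 = m.1
    · obtain ⟨m₀, hm₀, hA₀, hi₀⟩ := h
      have hb : ∑ m ∈ N, b i m = K * w m₀ - lam * q := by
        rw [sum_eq_single m₀ (fun m hm hne => if_neg fun h => ?_) (fun h => absurd hm₀ h)]
        · exact if_pos ⟨hA₀, hi₀⟩
        · exact (hNdisj m hm m₀ hm₀ hne).1 (h.2.symm.trans hi₀)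
      have hw₀ := weight_le_of_A m₀ hm₀ hA₀ i hi₀
      have hpw₀ := hpw m₀ (hNE hm₀)
      have hKK : (K - 1) * p ≤ (K - 1) * w m₀ := by
        refine mul_le_mul_of_nonneg_left hpw₀ ?_
        rw [one_le_div hlam0] at hK1
        linarith
      have hc2 : lam * q - (K - 1) * p ≤ c m₁ := by
        dsimp only [c]
        split_ifs
        · linarith
        · have := mul_le_mul_of_nonneg_left (hpw m₁ (hNE hm₁))
            (show 0 ≤ K / lam by linarith)
          linarith
      rw [hb]
      linarith
    · push Not at h
      have hb : ∑ m ∈ N, b i m = 0 :=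
        sum_eq_zero fun m hm => if_neg fun h' => h m hm h'.1 h'.2
      have hc2 : (w (g i) : ℝ) ≤ c m₁ := by
        dsimp only [c]
        split_ifs with hA
        · exact hwq _ (hgE i)
        · exact (weight_le_of_not_A m₁ hm₁ hA i r hr hrm₁).trans
            (le_mul_of_one_le_left (Nat.cast_nonneg _) hK1)
      rw [hb]
      linarith
  have total : ∀ m ∈ N, ∑ i, (((g i).2 ∩ m.2).card * c m + b i m) ≤ K * w m := by
    intro m hm
    have hcard : (∑ i, (((g i).2 ∩ m.2).card : ℝ)) ≤ lam := by
      exact_mod_cast (sum_card_inter_le_card (fun i j hij => (hgdisj i j hij).2) m.2).trans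
        (hE m (hNE hm)).2.2
    rw [sum_add_distrib, ← sum_mul]
    have hmul := mul_le_mul_of_nonneg_right hcard (hc0 m)
    by_cases hA : A m
    · have hcm : c m = q := if_pos hA
      obtain ⟨k, hk, -⟩ := id hA
      have hb : ∑ i, b i m = K * w m - lam * q := by
        rw [sum_eq_single k (fun i _ hne => if_neg fun h => ?_) (fun h => absurd (mem_univ k) h)]
        · exact if_pos ⟨hA, hk⟩
        · exact hne (driver_inj i k (h.2.trans hk.symm))
      rw [hb]
      rw [hcm] at hmul ⊢
      linarith
    · have hcm : c m = K / lam * w m := if_neg hA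
      have hb : ∑ i, b i m = 0 := sum_eq_zero fun i _ => if_neg fun h => hA h.1
      have hKl : (lam : ℝ) * (K / lam * w m) = K * w m := by field_simp
      rw [hb]
      rw [hcm] at hmul ⊢
      linarith
  calc ∑ i, (w (g i) : ℝ)
      ≤ ∑ i, ∑ m ∈ N, (((g i).2 ∩ m.2).card * c m + b i m) := sum_le_sum fun i _ => charge i
    _ = ∑ m ∈ N, ∑ i, (((g i).2 ∩ m.2).card * c m + b i m) := sum_comm
    _ ≤ ∑ m ∈ N, K * w m := sum_le_sum total
    _ = K * ∑ e ∈ N, (w e : ℝ) := (mul_sum _ _ _).symm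

/-- Theorem 3: Algorithm GreedyMinDist is a `(λ²μ+λ)/(λ+1)`-approximation for
MTRS-minDist, where `μ` is the ratio of the largest to the smallest match weight. -/
theorem greedyMinDist_approx {V : Type*} [DecidableEq V]
    (D R : Finset V) (lam : ℕ) (hlam : 2 ≤ lam) (hDR : Disjoint D R)
    (E : Finset (V × Finset V)) (hEne : E.Nonempty)
    (hE : ∀ e ∈ E, e.1 ∈ D ∧ e.2 ⊆ R ∧ e.2.Nonempty ∧ e.2.card ≤ lam)
    -- Assumption 2
    (hA2 : ∃ Δ ⊆ D, Δ.card = R.card ∧ ∀ η ∈ Δ, ∀ r ∈ R, (η, ({r} : Finset V)) ∈ E)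
    -- E is downward closed
    (hDC : ∀ η : V, ∀ S : Finset V, (η, S) ∈ E →
      ∀ S' ⊆ S, S'.Nonempty → (η, S') ∈ E)
    (w : V × Finset V → ℕ) (hw : ∀ e ∈ E, 1 ≤ w e)
    -- weights are monotone
    (hMono : ∀ η : V, ∀ S S' : Finset V, (η, S) ∈ E → (η, S') ∈ E → S' ⊆ S →
      w (η, S') ≤ w (η, S))
    -- M : a greedy min-weight solution
    (L : List (V × Finset V)) (hL : GreedyMinW E R w L)
    -- M* : a feasible solution of minimum total weight
    (Mstar : Finset (V × Finset V)) (hMstar : FeasSet E R Mstar)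
    (hopt : ∀ M', FeasSet E R M' → (∑ e ∈ Mstar, w e) ≤ (∑ e ∈ M', w e)) :
    ((L.map w).sum : ℝ) ≤
      (((lam : ℝ) ^ 2 *
          (((E.image w).max' (hEne.image w) : ℝ) / ((E.image w).min' (hEne.image w) : ℝ))
        + (lam : ℝ)) / ((lam : ℝ) + 1)) * ((∑ e ∈ Mstar, w e : ℕ) : ℝ) := by
  obtain ⟨⟨hLE, hLpw, -⟩, hgreedy⟩ := hL
  have hdisj : ∀ i j : Fin L.length, i ≠ j → MDisj (L.get i) (L.get j) := by
    intro i j hij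
    rcases lt_or_gt_of_ne hij with h | h
    · exact List.pairwise_iff_get.1 hLpw i j h
    · have := List.pairwise_iff_get.1 hLpw j i h
      exact ⟨this.1.symm, this.2.symm⟩
  have hsum : (L.map w).sum = ∑ i : Fin L.length, w (L.get i) := by
    simp [← Fin.sum_univ_fun_getElem]
  have hmin : ∀ e ∈ E, (E.image w).min' (hEne.image w) ≤ w e := fun e he =>
    min'_le _ _ (mem_image_of_mem w he)
  have hmax : ∀ e ∈ E, w e ≤ (E.image w).max' (hEne.image w) := fun e he =>
    le_max' _ _ (mem_image_of_mem w he)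
  have hpos : 0 < (E.image w).min' (hEne.image w) := by
    obtain ⟨e, he, h⟩ := mem_image.1 ((E.image w).min'_mem (hEne.image w))
    rw [← h]
    exact hw e he
  obtain ⟨e₀, he₀⟩ := id hEne
  rw [hsum]
  push_cast
  exact greedy_sum_le_factor_mul (by omega) (fun e he => (hE e he).2) hDC hMono
    (fun i => hLE _ (L.get_mem i)) hdisj hgreedy hMstar (by exact_mod_cast hpos)
    (by exact_mod_cast (hmin e₀ he₀).trans (hmax e₀ he₀))
    (fun e he => by exact_mod_cast hmin e he) (fun e he => by exact_mod_cast hmax e he) rfl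
end

section
/- Suppose E is downward closed. Let e_1,…,e_k be a greedy max-cardinality solution and let M* be a feasible solution. For 0 ≤ i ≤ k write M_i = {e_1,…,e_i} and let DM*_i = {e* ∈ M* : D(e*) ∈ {D(e_1),…,D(e_i)}}. Then for every i with 1 ≤ i ≤ min(k, |M*|) and every e* ∈ M* \ DM*_{i-1}, one has |R(e_i)| ≥ |R(e*) \ (R(e_1) ∪ ⋯ ∪ R(e_{i-1}))|. (Lemma 6 of the paper.) -/
open Finset

/-- A greedy max-cardinality solution: a feasible solution ordered so that each match
has maximum rider-set cardinality among all matches of `E` disjoint from all earlier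
ones. -/
def GreedyMaxC {V : Type*} [DecidableEq V] (E : Finset (V × Finset V)) (R : Finset V)
    (L : List (V × Finset V)) : Prop :=
  FeasList E R L ∧
  ∀ i : Fin L.length, ∀ f ∈ E,
    (∀ j : Fin L.length, (j : ℕ) < (i : ℕ) → MDisj f (L.get j)) →
    f.2.card ≤ (L.get i).2.card

/-- The set of riders covered by the first `i` matches of the list `L`. -/
def coveredBy {V : Type*} [DecidableEq V] (L : List (V × Finset V)) (i : ℕ) : Finset V :=
  (L.take i).foldr (fun e s => e.2 ∪ s) ∅

theorem subset_foldr_union_of_mem {V : Type*} [DecidableEq V] {L : List (V × Finset V)}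
    {e : V × Finset V} (he : e ∈ L) : e.2 ⊆ L.foldr (fun e s => e.2 ∪ s) ∅ := by
  induction L with
  | nil => simp at he
  | cons a L ih =>
    rw [List.foldr_cons]
    rcases List.mem_cons.mp he with rfl | he
    · exact subset_union_left
    · exact (ih he).trans subset_union_right

/-- Lemma 6: for each of the first `min(k,|M*|)` matches `e_i` of a greedy
max-cardinality solution and every `e* ∈ M*` whose driver is not used by the earlier
greedy matches, `|R(e_i)| ≥ |R(e*) \ (R(e_1) ∪ ⋯ ∪ R(e_{i-1}))|`
(here matches are indexed from `0`). -/
theorem greedyMinNum_property {V : Type*} [DecidableEq V]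
    (D R : Finset V) (lam : ℕ) (hDR : Disjoint D R)
    (E : Finset (V × Finset V))
    (hE : ∀ e ∈ E, e.1 ∈ D ∧ e.2 ⊆ R ∧ e.2.Nonempty ∧ e.2.card ≤ lam)
    -- E is downward closed
    (hDC : ∀ η : V, ∀ S : Finset V, (η, S) ∈ E →
      ∀ S' ⊆ S, S'.Nonempty → (η, S') ∈ E)
    (L : List (V × Finset V)) (hL : GreedyMaxC E R L)
    (Mstar : Finset (V × Finset V)) (hMstar : FeasSet E R Mstar) :
    ∀ i : Fin L.length, (i : ℕ) < Mstar.card →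
      ∀ estar ∈ Mstar, estar.1 ∉ (L.take (i : ℕ)).map Prod.fst →
        (estar.2 \ coveredBy L (i : ℕ)).card ≤ (L.get i).2.card := by
  intro i _ estar hmem hdriver
  rcases (estar.2 \ coveredBy L i).eq_empty_or_nonempty with hempty | hne
  · simp [hempty]
  · refine hL.2 i (estar.1, estar.2 \ coveredBy L i)
      (hDC estar.1 estar.2 (hMstar.1 hmem) _ sdiff_subset hne) fun j hj => ?_
    have hjmem : L.get j ∈ L.take (i : ℕ) :=
      List.mem_take_iff_getElem.mpr ⟨j, by omega, rfl⟩
    exact ⟨fun h => hdriver (List.mem_map.mpr ⟨L.get j, hjmem, h.symm⟩),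
      disjoint_sdiff_self_left.mono_right (subset_foldr_union_of_mem hjmem)⟩
end

section
/- Suppose E is downward closed. Let e_1,…,e_k be a greedy max-cardinality solution and let M* be a feasible solution with z = |M*| ≤ k. Then the first z matches of the greedy solution cover at least half of the riders: |R \ (R(e_1) ∪ ⋯ ∪ R(e_z))| ≤ |R(e_1) ∪ ⋯ ∪ R(e_z)|, and hence |R(e_1) ∪ ⋯ ∪ R(e_z)| ≥ |R|/2. (Intermediate claim in the proof of Theorem 4 of the paper.) -/
open Finset

theorem mem_foldr_union_snd {V : Type*} [DecidableEq V] {L : List (V × Finset V)} {x : V} :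
    x ∈ L.foldr (fun e s => e.2 ∪ s) ∅ ↔ ∃ e ∈ L, x ∈ e.2 := by
  induction L with
  | nil => simp
  | cons a l ih => simp [ih]

theorem card_foldr_union_snd {V : Type*} [DecidableEq V] {L : List (V × Finset V)}
    (h : L.Pairwise MDisj) :
    (L.foldr (fun e s => e.2 ∪ s) (∅ : Finset V)).card = (L.map fun e => e.2.card).sum := by
  induction L with
  | nil => simp
  | cons a l ih =>
    rw [List.pairwise_cons] at h
    have hd : Disjoint a.2 (l.foldr (fun e s => e.2 ∪ s) (∅ : Finset V)) := by
      rw [Finset.disjoint_left]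
      intro x hx hx'
      obtain ⟨e, he, hxe⟩ := mem_foldr_union_snd.1 hx'
      exact Finset.disjoint_left.1 (h.1 e he).2 hx hxe
    simp only [List.foldr_cons, List.map_cons, List.sum_cons]
    rw [Finset.card_union_of_disjoint hd, ih h.2]

theorem card_coveredBy {V : Type*} [DecidableEq V] {L : List (V × Finset V)}
    (h : L.Pairwise MDisj) {z : ℕ} (hz : z ≤ L.length) :
    (coveredBy L z).card = ∑ i : Fin z, (L.get (i.castLE hz)).2.card := by
  rw [coveredBy, card_foldr_union_snd (h.sublist (List.take_sublist z L)), ← List.sum_ofFn]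
  congr 1
  apply List.ext_getElem
  · simp [hz]
  · intro i h₁ h₂
    simp

/-- A match of `E` whose driver is not used before position `i` has at most as many riders
outside the first `z > i` greedy matches as the `i`-th greedy match has riders. -/
theorem card_sdiff_coveredBy_le {V : Type*} [DecidableEq V] {E : Finset (V × Finset V)}
    {R : Finset V} (hDC : ∀ η : V, ∀ S : Finset V, (η, S) ∈ E →
      ∀ S' ⊆ S, S'.Nonempty → (η, S') ∈ E)
    {L : List (V × Finset V)} (hL : GreedyMaxC E R L) {z : ℕ} (hz : z ≤ L.length) (i : Fin z)
    {m : V × Finset V} (hm : m ∈ E)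
    (hi : ∀ j : Fin z, j < i → (L.get (j.castLE hz)).1 ≠ m.1) :
    (m.2 \ coveredBy L z).card ≤ (L.get (i.castLE hz)).2.card := by
  rcases (m.2 \ coveredBy L z).eq_empty_or_nonempty with h | h
  · simp [h]
  refine hL.2 (i.castLE hz) (m.1, m.2 \ coveredBy L z)
    (hDC m.1 m.2 hm _ Finset.sdiff_subset h) fun j hj => ?_
  have hji : (j : ℕ) < i := hj
  have hjz : (j : ℕ) < z := hji.trans i.2
  refine ⟨fun he => hi ⟨j, hjz⟩ hji he.symm, ?_⟩
  rw [Finset.disjoint_left]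
  intro x hx hxj
  refine (Finset.mem_sdiff.1 hx).2 (mem_foldr_union_snd.2 ⟨L.get j, ?_, hxj⟩)
  exact List.mem_take_iff_getElem.2 ⟨j, by omega, rfl⟩

/-- Intermediate claim in the proof of Theorem 4: the first `z = |M*|` matches of a
greedy max-cardinality solution cover at least half of the riders. -/
theorem greedyMinNum_half_cover {V : Type*} [DecidableEq V]
    (D R : Finset V) (lam : ℕ) (hDR : Disjoint D R)
    (E : Finset (V × Finset V))
    (hE : ∀ e ∈ E, e.1 ∈ D ∧ e.2 ⊆ R ∧ e.2.Nonempty ∧ e.2.card ≤ lam)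
    -- E is downward closed
    (hDC : ∀ η : V, ∀ S : Finset V, (η, S) ∈ E →
      ∀ S' ⊆ S, S'.Nonempty → (η, S') ∈ E)
    (L : List (V × Finset V)) (hL : GreedyMaxC E R L)
    (Mstar : Finset (V × Finset V)) (hMstar : FeasSet E R Mstar)
    (hz : Mstar.card ≤ L.length) :
    (R \ coveredBy L Mstar.card).card ≤ (coveredBy L Mstar.card).card ∧
    (R.card : ℝ) / 2 ≤ ((coveredBy L Mstar.card).card : ℝ) := by
  obtain ⟨hME, hMd, hMR⟩ := hMstar
  set z := Mstar.card with hzdef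
  have hpw := hL.1.2.1
  have hinj : ∀ i j : Fin z, (L.get (i.castLE hz)).1 = (L.get (j.castLE hz)).1 → i = j := by
    intro i j hij
    by_contra hne
    rcases lt_or_gt_of_ne hne with h | h
    · exact (List.pairwise_iff_get.1 hpw (i.castLE hz) (j.castLE hz) h).1 hij
    · exact (List.pairwise_iff_get.1 hpw (j.castLE hz) (i.castLE hz) h).1 hij.symm
  classical
  let used : Finset Mstar := {m | ∃ i : Fin z, (L.get (i.castLE hz)).1 = m.1.1}
  have hf : ∀ m : Mstar, ∃ i : Fin z, m ∈ used → (L.get (i.castLE hz)).1 = m.1.1 := by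
    intro m
    by_cases hm : m ∈ used
    · obtain ⟨i, hi⟩ := (Finset.mem_filter.1 hm).2
      exact ⟨i, fun _ => hi⟩
    · exact ⟨⟨0, Finset.card_pos.2 ⟨m.1, m.2⟩⟩, fun h => absurd h hm⟩
  choose f hf using hf
  have hfinj : Set.InjOn f used := by
    intro a ha b hb hab
    by_contra hne
    refine (hMd a a.2 b b.2 fun h => hne (Subtype.ext h)).1 ?_
    rw [← hf a ha, ← hf b hb, hab]
  obtain ⟨g, hg⟩ := Finset.exists_equiv_extend_of_card_eq (t := (univ : Finset (Fin z)))
    (by simp [hzdef]) (Finset.subset_univ _) hfinj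
  have hle : ∀ m : Mstar,
      (m.1.2 \ coveredBy L z).card ≤ (L.get ((g m : Fin z).castLE hz)).2.card := by
    intro m
    refine card_sdiff_coveredBy_le hDC hL hz _ (hME m.2) fun j hj hjm => ?_
    have hm : m ∈ used := Finset.mem_filter.2 ⟨Finset.mem_univ _, j, hjm⟩
    have := hinj j (g m) (by rw [hjm, hg m hm, hf m hm])
    exact hj.ne this
  have hmain : (R \ coveredBy L z).card ≤ (coveredBy L z).card := by
    calc (R \ coveredBy L z).card
        ≤ (Mstar.biUnion fun m => m.2 \ coveredBy L z).card := by
          refine Finset.card_le_card fun x hx => ?_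
          rw [← hMR] at hx
          simp only [Finset.mem_sdiff, Finset.mem_biUnion] at hx ⊢
          obtain ⟨⟨m, hm, hxm⟩, hxC⟩ := hx
          exact ⟨m, hm, hxm, hxC⟩
      _ ≤ ∑ m ∈ Mstar, (m.2 \ coveredBy L z).card := Finset.card_biUnion_le
      _ = ∑ m : Mstar, (m.1.2 \ coveredBy L z).card :=
          (Finset.sum_coe_sort Mstar fun m => (m.2 \ coveredBy L z).card).symm
      _ ≤ ∑ m : Mstar, (L.get ((g m : Fin z).castLE hz)).2.card :=
          Finset.sum_le_sum fun m _ => hle m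
      _ = ∑ i : (univ : Finset (Fin z)), (L.get ((i : Fin z).castLE hz)).2.card :=
          g.sum_comp fun i => (L.get ((i : Fin z).castLE hz)).2.card
      _ = ∑ i : Fin z, (L.get (i.castLE hz)).2.card :=
          Finset.sum_coe_sort univ fun i : Fin z => (L.get (i.castLE hz)).2.card
      _ = (coveredBy L z).card := (card_coveredBy hpw hz).symm
  refine ⟨hmain, ?_⟩
  have h : R.card ≤ (R \ coveredBy L z).card + (coveredBy L z).card :=
    Finset.card_le_card_sdiff_add_card
  have h' : (R.card : ℝ) ≤ 2 * (coveredBy L z).card := by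
    exact_mod_cast (by omega : R.card ≤ 2 * (coveredBy L z).card)
  linarith
end

section
/- Suppose Assumption 2 holds, E is downward closed, and λ ≥ 2. Let e_1,…,e_k be a greedy max-cardinality solution (a solution of Algorithm GreedyMinNum) and let M* be a feasible solution of minimum cardinality. Then k ≤ ((λ + 2)/2) · |M*|. (Theorem 4 of the paper: Algorithm GreedyMinNum is a (λ+2)/2-approximation for MTRS-minNum.) -/
open Finset

/-- The matches of a feasible list form a feasible set of the same cardinality. -/
theorem FeasList.feasSet_toFinset {V : Type*} [DecidableEq V] {E : Finset (V × Finset V)}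
    {R : Finset V} {L : List (V × Finset V)} (h : FeasList E R L) :
    FeasSet E R L.toFinset ∧ L.toFinset.card = L.length := by
  obtain ⟨hE, hP, hR⟩ := h
  refine ⟨⟨fun e he => hE e (List.mem_toFinset.1 he), fun e he f hf hef => ?_, ?_⟩,
    List.toFinset_card_of_nodup (hP.imp fun h hef => h.1 (congrArg Prod.fst hef))⟩
  · refine List.Pairwise.forall_of_forall_of_flip (R := fun e f => e ≠ f → MDisj e f)
      (fun _ _ h => absurd rfl h) (hP.imp ?_) (hP.imp ?_)
      (List.mem_toFinset.1 he) (List.mem_toFinset.1 hf) hef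
    exacts [fun h _ => h, fun h _ => ⟨h.1.symm, h.2.symm⟩]
  · rw [← hR]
    clear hE hP hR
    induction L with
    | nil => rfl
    | cons a L ih => rw [List.toFinset_cons, biUnion_insert, ih, List.foldr_cons]

/-- Every match meets some match of a greedy solution that is at least as large. -/
theorem GreedyMaxC.exists_not_mDisj {V : Type*} [DecidableEq V] {E : Finset (V × Finset V)}
    {R : Finset V} {L : List (V × Finset V)} (hL : GreedyMaxC E R L) {f : V × Finset V}
    (hf : f ∈ E) (hfR : f.2 ⊆ R) (hne : f.2.Nonempty) :
    ∃ e ∈ L, ¬ MDisj f e ∧ f.2.card ≤ e.2.card := by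
  classical
  have hex : ∃ i, ∃ h : i < L.length, ¬ MDisj f L[i] := by
    obtain ⟨r, hr⟩ := hne
    have hrR := hfR hr
    rw [← hL.1.feasSet_toFinset.1.2.2, mem_biUnion] at hrR
    obtain ⟨e, he, hre⟩ := hrR
    obtain ⟨i, hi, rfl⟩ := List.mem_iff_getElem.1 (List.mem_toFinset.1 he)
    exact ⟨i, hi, fun h => disjoint_left.1 h.2 hr hre⟩
  obtain ⟨hi, hmeet⟩ := Nat.find_spec hex
  refine ⟨_, List.getElem_mem hi, hmeet, hL.2 ⟨_, hi⟩ f hf fun j hj => ?_⟩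
  by_contra h
  exact Nat.find_min hex hj ⟨j.2, h⟩

/-- Theorem 4: Algorithm GreedyMinNum is a `(λ+2)/2`-approximation for MTRS-minNum. -/
theorem greedyMinNum_approx {V : Type*} [DecidableEq V]
    (D R : Finset V) (lam : ℕ) (hlam : 2 ≤ lam) (hDR : Disjoint D R)
    (E : Finset (V × Finset V))
    (hE : ∀ e ∈ E, e.1 ∈ D ∧ e.2 ⊆ R ∧ e.2.Nonempty ∧ e.2.card ≤ lam)
    -- Assumption 2
    (hA2 : ∃ Δ ⊆ D, Δ.card = R.card ∧ ∀ η ∈ Δ, ∀ r ∈ R, (η, ({r} : Finset V)) ∈ E)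
    -- E is downward closed
    (hDC : ∀ η : V, ∀ S : Finset V, (η, S) ∈ E →
      ∀ S' ⊆ S, S'.Nonempty → (η, S') ∈ E)
    -- a greedy max-cardinality solution with k matches
    (L : List (V × Finset V)) (hL : GreedyMaxC E R L)
    -- M* : a feasible solution of minimum cardinality
    (Mstar : Finset (V × Finset V)) (hMstar : FeasSet E R Mstar)
    (hopt : ∀ M', FeasSet E R M' → Mstar.card ≤ M'.card) :
    (L.length : ℝ) ≤ (((lam : ℝ) + 2) / 2) * (Mstar.card : ℝ) := by
  obtain ⟨hA, hlen⟩ := hL.1.feasSet_toFinset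
  set A := L.toFinset
  set B := A.filter fun e => e.2.card = 1
  set T := B.biUnion Prod.snd with hT
  have hdisjA : (A : Set (V × Finset V)).PairwiseDisjoint Prod.snd :=
    fun e he f hf hef => (hA.2.1 e he f hf hef).2
  have hTcard : T.card = B.card := by
    rw [hT, card_biUnion fun e he f hf hef =>
      hdisjA (mem_filter.1 he).1 (mem_filter.1 hf).1 hef]
    exact (sum_congr rfl fun e he => (mem_filter.1 he).2).trans (card_eq_sum_ones B).symm
  have hRcard : R.card = ∑ e ∈ A, e.2.card := by
    rw [← hA.2.2, card_biUnion hdisjA]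
  have hRle : R.card ≤ Mstar.card * lam := by
    rw [← hMstar.2.2]
    exact card_biUnion_le_card_mul _ _ _ fun e he => (hE e (hMstar.1 he)).2.2.2
  -- the riders of an optimal match that the greedy solution serves alone
  have hlocal : ∀ f ∈ Mstar,
      (f.2 ∩ T).card ≤ 2 + ∑ e ∈ A with e.1 = f.1, (e.2.card - 2) := by
    intro f hf
    have hfE := hMstar.1 hf
    rcases (f.2 ∩ T).eq_empty_or_nonempty with h0 | hne
    · simp [h0]
    obtain ⟨e, heL, hmeet, hle⟩ := hL.exists_not_mDisj
      (hDC f.1 f.2 hfE _ inter_subset_left hne)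
      (inter_subset_left.trans (hE f hfE).2.1) hne
    have heA : e ∈ A := List.mem_toFinset.2 heL
    dsimp only at hle
    by_cases hdr : e.1 = f.1
    · have := single_le_sum (f := fun e : V × Finset V => e.2.card - 2)
        (s := A.filter fun e => e.1 = f.1) (fun _ _ => Nat.zero_le _)
        (mem_filter.2 ⟨heA, hdr⟩)
      omega
    · have hnd : ¬ Disjoint (f.2 ∩ T) e.2 := fun h => hmeet ⟨Ne.symm hdr, h⟩
      obtain ⟨r, hr, hre⟩ := not_disjoint_iff.1 hnd
      obtain ⟨g, hg, hrg⟩ := mem_biUnion.1 (mem_inter.1 hr).2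
      obtain ⟨hgA, hg1⟩ := mem_filter.1 hg
      have hge : g = e := by
        by_contra hge
        exact disjoint_left.1 (hdisjA hgA heA hge) hrg hre
      subst hge
      omega
  have hTle : T.card ≤ ∑ f ∈ Mstar, (f.2 ∩ T).card := by
    refine le_trans (card_le_card fun r hr => ?_) card_biUnion_le
    obtain ⟨g, hg, hrg⟩ := mem_biUnion.1 hr
    have hrR : r ∈ R := (hE g (hA.1 (mem_filter.1 hg).1)).2.1 hrg
    rw [← hMstar.2.2] at hrR
    obtain ⟨f, hf, hrf⟩ := mem_biUnion.1 hrR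
    exact mem_biUnion.2 ⟨f, hf, mem_inter.2 ⟨hrf, hr⟩⟩
  have hdrivers : ∑ f ∈ Mstar, ∑ e ∈ A with e.1 = f.1, (e.2.card - 2)
      ≤ ∑ e ∈ A, (e.2.card - 2) := by
    rw [← sum_biUnion]
    · exact sum_le_sum_of_subset (biUnion_subset.2 fun f _ => filter_subset _ _)
    · intro f hf g hg hfg
      refine disjoint_left.2 fun e hef heg => ?_
      exact (hMstar.2.1 f hf g hg hfg).1
        ((mem_filter.1 hef).2.symm.trans (mem_filter.1 heg).2)
  have hsum := sum_le_sum hlocal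
  rw [sum_add_distrib, sum_const, smul_eq_mul] at hsum
  have hcount : A.card * 2 + ∑ e ∈ A, (e.2.card - 2) = R.card + B.card := by
    rw [hRcard, card_filter, ← sum_add_distrib, ← smul_eq_mul, ← sum_const,
      ← sum_add_distrib]
    refine sum_congr rfl fun e he => ?_
    have := card_pos.2 (hE e (hA.1 he)).2.2.1
    split_ifs <;> omega
  have hmain : L.length * 2 ≤ Mstar.card * lam + Mstar.card * 2 := by omega
  have hcast : (L.length : ℝ) * 2 ≤ Mstar.card * lam + Mstar.card * 2 := by
    exact_mod_cast hmain
  linarith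
end

section
/- In the weighted set system constructed from a 3-dimensional matching instance (A, B, C, F) with |A| = 2q and |B| = |C| = q, the family F admits a 3-dimensional matching of cardinality q if and only if the minimum total weight of a feasible solution equals 2q. (Lemma 1 of the paper, establishing the reduction used to prove NP-hardness of MTRS-minDist.) -/
open Finset
open scoped Classical

/-- A 3-dimensional matching: a set of triples no two of which share a first, second, or
third component. -/
def Is3DMatching {V : Type*} (M : Finset (V × V × V)) : Prop :=
  ∀ f ∈ M, ∀ g ∈ M, f ≠ g → f.1 ≠ g.1 ∧ f.2.1 ≠ g.2.1 ∧ f.2.2 ≠ g.2.2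

/-- The set system constructed from a 3DM instance `(A,B,C,F)`: for each triple
`(a,b,c) ∈ F` the matches `(a,{b,c})`, `(a,{b})`, `(a,{c})`, and additionally the
matches `(a,{b})` and `(a,{c})` for every pair `a ∈ A, b ∈ B` and `a ∈ A, c ∈ C`. -/
def E3DM {V : Type*} [DecidableEq V] (A B C : Finset V) (F : Finset (V × V × V)) :
    Finset (V × Finset V) :=
  F.image (fun f => (f.1, ({f.2.1, f.2.2} : Finset V))) ∪
  (A ×ˢ (B ∪ C)).image (fun p => (p.1, ({p.2} : Finset V)))

/-- The weight function of the construction: matches created from triples of `F` have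
weight `2`; all other (singleton) matches have weight `ω`. -/
noncomputable def w3DM {V : Type*} [DecidableEq V] (F : Finset (V × V × V)) (ω : ℕ)
    (e : V × Finset V) : ℕ :=
  if ∃ f ∈ F, f.1 = e.1 ∧ (e.2 = {f.2.1, f.2.2} ∨ e.2 = {f.2.1} ∨ e.2 = {f.2.2})
  then 2 else ω

/-- The match `(a, {b, c})` serving both riders of a triple `(a, b, c)`. -/
def tripleMatch {V : Type*} [DecidableEq V] (f : V × V × V) : V × Finset V :=
  (f.1, {f.2.1, f.2.2})

lemma card_tripleMatch_snd {V : Type*} [DecidableEq V] {B C : Finset V} (hBC : Disjoint B C)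
    {f : V × V × V} (hb : f.2.1 ∈ B) (hc : f.2.2 ∈ C) : (tripleMatch f).2.card = 2 :=
  card_pair (disjoint_iff_ne.mp hBC _ hb _ hc)

lemma tripleMatch_injOn {V : Type*} [DecidableEq V] {B C : Finset V} (hBC : Disjoint B C)
    {F : Finset (V × V × V)} (hF : ∀ f ∈ F, f.2.1 ∈ B ∧ f.2.2 ∈ C) :
    Set.InjOn tripleMatch (F : Set (V × V × V)) := by
  rintro ⟨a, b, c⟩ hf ⟨a', b', c'⟩ hg h
  obtain ⟨hb, hc⟩ := hF _ hf
  obtain ⟨hb', hc'⟩ := hF _ hg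
  have hne := disjoint_iff_ne.mp hBC
  simp only [tripleMatch, Prod.mk.injEq] at h
  obtain ⟨rfl, h⟩ := h
  have h₁ : b ∈ ({b', c'} : Finset V) := h ▸ mem_insert_self b {c}
  have h₂ : c ∈ ({b', c'} : Finset V) := h ▸ mem_insert_of_mem (mem_singleton_self c)
  rw [mem_insert, mem_singleton] at h₁ h₂
  rw [h₁.resolve_right (hne b hb c' hc'), h₂.resolve_left (hne b' hb' c hc).symm]

lemma two_le_w3DM {V : Type*} [DecidableEq V] (F : Finset (V × V × V)) {ω : ℕ} (hω : 2 ≤ ω)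
    (e : V × Finset V) : 2 ≤ w3DM F ω e := by
  unfold w3DM
  split_ifs <;> omega

lemma w3DM_tripleMatch {V : Type*} [DecidableEq V] {F : Finset (V × V × V)} (ω : ℕ)
    {f : V × V × V} (hf : f ∈ F) : w3DM F ω (tripleMatch f) = 2 :=
  if_pos ⟨f, hf, rfl, Or.inl rfl⟩

lemma tripleMatch_mem_E3DM {V : Type*} [DecidableEq V] (A B C : Finset V)
    {F : Finset (V × V × V)} {f : V × V × V} (hf : f ∈ F) : tripleMatch f ∈ E3DM A B C F :=
  mem_union_left _ (mem_image_of_mem _ hf)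

lemma exists_tripleMatch_or_card_eq_one {V : Type*} [DecidableEq V] {A B C : Finset V}
    {F : Finset (V × V × V)} {e : V × Finset V} (he : e ∈ E3DM A B C F) :
    (∃ f ∈ F, tripleMatch f = e) ∨ e.2.card = 1 := by
  rcases mem_union.mp he with he | he
  · exact Or.inl (mem_image.mp he)
  · obtain ⟨p, -, rfl⟩ := mem_image.mp he
    exact Or.inr (card_singleton _)

lemma card_snd_le_two {V : Type*} [DecidableEq V] {A B C : Finset V}
    {F : Finset (V × V × V)} {e : V × Finset V} (he : e ∈ E3DM A B C F) : e.2.card ≤ 2 := by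
  rcases exists_tripleMatch_or_card_eq_one he with ⟨f, -, rfl⟩ | h
  · exact card_le_two
  · omega

lemma FeasSet.sum_card {V : Type*} [DecidableEq V] {E M : Finset (V × Finset V)} {R : Finset V}
    (h : FeasSet E R M) : ∑ e ∈ M, e.2.card = R.card := by
  rw [← h.2.2, card_biUnion fun e he f hf hne => (h.2.1 e he f hf hne).2]

lemma Is3DMatching.mDisj_tripleMatch {V : Type*} [DecidableEq V] {B C : Finset V}
    (hBC : Disjoint B C) {M : Finset (V × V × V)} (hM : Is3DMatching M)
    (hMBC : ∀ f ∈ M, f.2.1 ∈ B ∧ f.2.2 ∈ C) {f g : V × V × V} (hf : f ∈ M) (hg : g ∈ M)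
    (hne : f ≠ g) : MDisj (tripleMatch f) (tripleMatch g) := by
  obtain ⟨h₁, h₂, h₃⟩ := hM f hf g hg hne
  have hfg := disjoint_iff_ne.mp hBC _ (hMBC f hf).1 _ (hMBC g hg).2
  have hgf := disjoint_iff_ne.mp hBC _ (hMBC g hg).1 _ (hMBC f hf).2
  refine ⟨h₁, ?_⟩
  simp only [tripleMatch, disjoint_insert_left, disjoint_singleton_left, mem_insert,
    mem_singleton]
  grind

/-- A 3-dimensional matching as large as `B` and `C` induces a feasible solution. -/
lemma Is3DMatching.feasSet_image {V : Type*} [DecidableEq V] {q : ℕ} {A B C : Finset V}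
    (hBC : Disjoint B C) (hB : B.card = q) (hC : C.card = q) {F M : Finset (V × V × V)}
    (hF : ∀ f ∈ F, f.2.1 ∈ B ∧ f.2.2 ∈ C) (hMF : M ⊆ F) (hM : Is3DMatching M)
    (hMq : M.card = q) : FeasSet (E3DM A B C F) (B ∪ C) (M.image tripleMatch) := by
  have hMBC : ∀ f ∈ M, f.2.1 ∈ B ∧ f.2.2 ∈ C := fun f hf => hF f (hMF hf)
  refine ⟨?_, ?_, ?_⟩
  · exact image_subset_iff.mpr fun f hf => tripleMatch_mem_E3DM A B C (hMF hf)
  · simp only [forall_mem_image]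
    exact fun f hf g hg hne =>
      hM.mDisj_tripleMatch hBC hMBC hf hg fun h => hne (congrArg tripleMatch h)
  · rw [image_biUnion]
    refine eq_of_subset_of_card_le ?_ ?_
    · refine biUnion_subset.mpr fun f hf => ?_
      exact insert_subset (mem_union_left _ (hMBC f hf).1)
        (singleton_subset_iff.mpr (mem_union_right _ (hMBC f hf).2))
    · rw [card_biUnion fun f hf g hg hne => (hM.mDisj_tripleMatch hBC hMBC hf hg hne).2,
        sum_congr rfl fun f hf => card_tripleMatch_snd hBC (hMBC f hf).1 (hMBC f hf).2,
        card_union_of_disjoint hBC, sum_const, smul_eq_mul]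
      omega

/-- The triples whose matches are used by a feasible solution form a 3-dimensional matching. -/
lemma FeasSet.is3DMatching_filter {V : Type*} [DecidableEq V] {E M : Finset (V × Finset V)}
    {R B C : Finset V} (hBC : Disjoint B C) {F : Finset (V × V × V)}
    (hF : ∀ f ∈ F, f.2.1 ∈ B ∧ f.2.2 ∈ C) (h : FeasSet E R M) :
    Is3DMatching (F.filter fun f => tripleMatch f ∈ M) := by
  intro f hf g hg hne
  rw [mem_filter] at hf hg
  obtain ⟨h₁, h₂⟩ := h.2.1 _ hf.2 _ hg.2
    fun h => hne (tripleMatch_injOn hBC hF hf.1 hg.1 h)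
  have h₃ := disjoint_iff_ne.mp h₂
  exact ⟨h₁, h₃ _ (mem_insert_self _ _) _ (mem_insert_self _ _),
    h₃ _ (mem_insert_of_mem (mem_singleton_self _)) _ (mem_insert_of_mem (mem_singleton_self _))⟩

/-- Lemma 1: the 3DM instance `(A,B,C,F)` with `|A| = 2q`, `|B| = |C| = q` has a
3-dimensional matching of cardinality `q` iff the minimum total weight of a feasible
solution of the constructed weighted set system is `2q`. -/
theorem threeDM_iff_minDist {V : Type*} [DecidableEq V] (q : ℕ) (hq : 1 ≤ q)
    (A B C : Finset V) (hAB : Disjoint A B) (hAC : Disjoint A C) (hBC : Disjoint B C)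
    (hA : A.card = 2 * q) (hB : B.card = q) (hC : C.card = q)
    (F : Finset (V × V × V)) (hF : ∀ f ∈ F, f.1 ∈ A ∧ f.2.1 ∈ B ∧ f.2.2 ∈ C)
    (ω : ℕ) (hω : 2 ≤ ω) :
    (∃ M ⊆ F, Is3DMatching M ∧ M.card = q) ↔
    IsLeast {n : ℕ | ∃ M : Finset (V × Finset V),
      FeasSet (E3DM A B C F) (B ∪ C) M ∧ (∑ e ∈ M, w3DM F ω e) = n} (2 * q) := by
  have hF' : ∀ f ∈ F, f.2.1 ∈ B ∧ f.2.2 ∈ C := fun f hf => (hF f hf).2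
  have hR : (B ∪ C).card = 2 * q := by
    rw [card_union_of_disjoint hBC]
    omega
  constructor
  · rintro ⟨M, hMF, hM, hMq⟩
    refine ⟨⟨M.image tripleMatch, hM.feasSet_image hBC hB hC hF' hMF hMq, ?_⟩, ?_⟩
    · rw [sum_image ((tripleMatch_injOn hBC hF').mono (coe_subset.mpr hMF)),
        sum_congr rfl fun f hf => w3DM_tripleMatch ω (hMF hf), sum_const, smul_eq_mul]
      omega
    · rintro n ⟨N, hN, rfl⟩
      rw [← hR, ← hN.sum_card]
      exact sum_le_sum fun e he => (card_snd_le_two (hN.1 he)).trans (two_le_w3DM F hω e)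
  · rintro ⟨⟨M, hM, hw⟩, -⟩
    have hle : ∀ e ∈ M, e.2.card ≤ w3DM F ω e := fun e he =>
      (card_snd_le_two (hM.1 he)).trans (two_le_w3DM F hω e)
    have hcard : ∀ e ∈ M, e.2.card = w3DM F ω e :=
      (sum_eq_sum_iff_of_le hle).mp (by rw [hM.sum_card, hR, hw])
    have hcard₂ : ∀ e ∈ M, e.2.card = 2 := fun e he =>
      le_antisymm (card_snd_le_two (hM.1 he)) (hcard e he ▸ two_le_w3DM F hω e)
    have himage : (F.filter fun f => tripleMatch f ∈ M).image tripleMatch = M := by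
      ext e
      simp only [mem_image, mem_filter]
      constructor
      · rintro ⟨f, ⟨-, hf⟩, rfl⟩
        exact hf
      · intro he
        rcases exists_tripleMatch_or_card_eq_one (hM.1 he) with ⟨f, hf, rfl⟩ | h
        · exact ⟨f, ⟨hf, he⟩, rfl⟩
        · have := hcard₂ e he
          omega
    refine ⟨_, filter_subset _ F, hM.is3DMatching_filter hBC hF', ?_⟩
    have hMq := hM.sum_card
    rw [sum_congr rfl hcard₂, sum_const, smul_eq_mul, hR] at hMq
    rw [← card_image_of_injOn
      ((tripleMatch_injOn hBC hF').mono (coe_subset.mpr (filter_subset _ F))), himage]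
    omega
end
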